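/- Let μ ∈ M(X_1,T_1) and let U_i be open covers of X_i, i=1,…,k. Then limsup_{N→∞} (1/N) H_μ( ⋁_{i=1}^k (τ_{i−1}^{−1}U_i)_0^{⌈(a_1+…+a_i)N⌉−1} ) ≤ Σ_{i=1}^k a_i h_μ(T_1, ⋁_{j=i}^k τ_{j−1}^{−1}U_j) ≤ Σ_{i=1}^k a_i h_{τ_{i−1}μ}(T_i). -/

import Mathlib

open MeasureTheory Set Filter Topology
open scoped ENNReal symmDiff

namespace WTP

variable {k : ℕ}

/-- cumulative weight `a 1 + … + a i` (zero-indexed: `a 0 + … + a i`). -/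
noncomputable def cw (a : Fin k → ℝ) (i : Fin k) : ℝ := ∑ j ∈ Finset.Iic i, a j

/-- Birkhoff sum `S_n f = ∑_{l<n} f ∘ T^l`. -/
noncomputable def birk {X : Type*} (T : X → X) (f : X → ℝ) (n : ℕ) (x : X) : ℝ :=
  ∑ l ∈ Finset.range n, f (T^[l] x)

/-- a (finite) open cover of a topological space. -/
def IsOpenCover {X : Type*} [TopologicalSpace X] (𝒰 : Set (Set X)) : Prop :=
  𝒰.Finite ∧ (∀ U ∈ 𝒰, IsOpen U) ∧ ⋃₀ 𝒰 = Set.univ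

/-- pullback of a cover along a map. -/
def pullCov {X Y : Type*} (g : X → Y) (𝒰 : Set (Set Y)) : Set (Set X) :=
  (fun U => g ⁻¹' U) '' 𝒰

/-- the quantity `exp(−s·n + (1/a₁)·sup_{x∈A} S_{⌈a₁ n⌉} f(x))`, as an element of `ℝ≥0∞`. -/
noncomputable def pterm {X : Type*} (T1 : X → X) (f : X → ℝ) (a1 s : ℝ) (n : ℕ)
    (A : Set X) : ℝ≥0∞ :=
  ENNReal.ofReal (Real.exp (-(s * n) + (1 / a1) * sSup (birk T1 f ⌈a1 * (n : ℝ)⌉₊ '' A)))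

/-- the weighted Bowen ball `B_n^𝐚(x, ε)`. -/
def wBowen {X : Fin k → Type*} [∀ i, MetricSpace (X i)] {X1 : Type*}
    (T : ∀ i, X i → X i) (τ : ∀ i, X1 → X i) (a : Fin k → ℝ)
    (n : ℕ) (x : X1) (ε : ℝ) : Set X1 :=
  {y | ∀ i : Fin k, ∀ j < ⌈cw a i * (n : ℝ)⌉₊,
      dist ((T i)^[j] (τ i x)) ((T i)^[j] (τ i y)) < ε}

section Bowen

variable [NeZero k] {X : Fin k → Type*} [∀ i, MetricSpace (X i)] {X1 : Type*}
  [MeasurableSpace X1]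

/-- `Λ^{𝐚,s}_{N,ε}(Z,f)`. -/
noncomputable def lamBowenN (T1 : X1 → X1) (T : ∀ i, X i → X i) (τ : ∀ i, X1 → X i)
    (a : Fin k → ℝ) (f : X1 → ℝ) (s ε : ℝ) (N : ℕ) (Z : Set X1) : ℝ≥0∞ :=
  ⨅ (D : Set (ℕ × Set X1)) (_ : D.Countable)
    (_ : ∀ p ∈ D, N ≤ p.1 ∧ MeasurableSet p.2 ∧ ∃ x : X1, p.2 ⊆ wBowen T τ a p.1 x ε)
    (_ : Z ⊆ ⋃ p ∈ D, p.2),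
    ∑' p : D, pterm T1 f (a 0) s p.1.1 p.1.2

/-- `Λ^{𝐚,s}_{ε}(Z,f) = lim_{N→∞} Λ^{𝐚,s}_{N,ε}(Z,f)` (an increasing limit). -/
noncomputable def lamBowen (T1 : X1 → X1) (T : ∀ i, X i → X i) (τ : ∀ i, X1 → X i)
    (a : Fin k → ℝ) (f : X1 → ℝ) (s ε : ℝ) (Z : Set X1) : ℝ≥0∞ :=
  ⨆ N : ℕ, lamBowenN T1 T τ a f s ε N Z

/-- `P^𝐚(T₁, Z, ε, f) = inf {s : Λ^{𝐚,s}_ε(Z,f) = 0}`. -/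
noncomputable def PBowenEps (T1 : X1 → X1) (T : ∀ i, X i → X i) (τ : ∀ i, X1 → X i)
    (a : Fin k → ℝ) (Z : Set X1) (f : X1 → ℝ) (ε : ℝ) : EReal :=
  sInf (Real.toEReal '' {s : ℝ | lamBowen T1 T τ a f s ε Z = 0})

/-- the 𝐚-weighted topological pressure `P^𝐚(T₁, Z, f) = lim_{ε→0} P^𝐚(T₁, Z, ε, f)`
(an increasing limit as `ε` decreases to `0`). -/
noncomputable def PBowen (T1 : X1 → X1) (T : ∀ i, X i → X i) (τ : ∀ i, X1 → X i)
    (a : Fin k → ℝ) (Z : Set X1) (f : X1 → ℝ) : EReal :=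
  ⨆ ε : {e : ℝ // 0 < e}, PBowenEps T1 T τ a Z f ε.1

/-- `W^{𝐚,s}_{N,ε}(Z,f)`. -/
noncomputable def wBowenWN (T1 : X1 → X1) (T : ∀ i, X i → X i) (τ : ∀ i, X1 → X i)
    (a : Fin k → ℝ) (f : X1 → ℝ) (s ε : ℝ) (N : ℕ) (Z : Set X1) : ℝ≥0∞ :=
  ⨅ (D : Set (ℕ × Set X1 × ℝ≥0∞)) (_ : D.Countable)
    (_ : ∀ p ∈ D, N ≤ p.1 ∧ MeasurableSet p.2.1 ∧ 0 < p.2.2 ∧ p.2.2 ≠ ⊤ ∧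
        ∃ x : X1, p.2.1 ⊆ wBowen T τ a p.1 x ε)
    (_ : ∀ z ∈ Z, 1 ≤ ∑' p : D, (p.1.2.1).indicator (fun _ => p.1.2.2) z),
    ∑' p : D, p.1.2.2 * pterm T1 f (a 0) s p.1.1 p.1.2.1

/-- `W^{𝐚,s}_{ε}(Z,f)`. -/
noncomputable def wBowenW (T1 : X1 → X1) (T : ∀ i, X i → X i) (τ : ∀ i, X1 → X i)
    (a : Fin k → ℝ) (f : X1 → ℝ) (s ε : ℝ) (Z : Set X1) : ℝ≥0∞ :=
  ⨆ N : ℕ, wBowenWN T1 T τ a f s ε N Z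

/-- `P_W^𝐚(T₁, Z, ε, f)`. -/
noncomputable def PWBowenEps (T1 : X1 → X1) (T : ∀ i, X i → X i) (τ : ∀ i, X1 → X i)
    (a : Fin k → ℝ) (Z : Set X1) (f : X1 → ℝ) (ε : ℝ) : EReal :=
  sInf (Real.toEReal '' {s : ℝ | wBowenW T1 T τ a f s ε Z = 0})

/-- the average 𝐚-weighted topological pressure `P_W^𝐚(T₁, Z, f)`. -/
noncomputable def PWBowen (T1 : X1 → X1) (T : ∀ i, X i → X i) (τ : ∀ i, X1 → X i)
    (a : Fin k → ℝ) (Z : Set X1) (f : X1 → ℝ) : EReal :=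
  ⨆ ε : {e : ℝ // 0 < e}, PWBowenEps T1 T τ a Z f ε.1

end Bowen

section Local

variable [NeZero k] {X1 : Type*} [MeasurableSpace X1]

/-- the cover `⋁_{i=1}^k (τ_{i-1}^{-1} 𝒰_i)_0^{⌈(a_1+…+a_i) n⌉ - 1}` on the first space, where
`𝒱 i` is the pulled back cover `τ_{i-1}^{-1} 𝒰_i`. -/
def jointFiber (T1 : X1 → X1) (a : Fin k → ℝ) (𝒱 : Fin k → Set (Set X1)) (n : ℕ) :
    Set (Set X1) :=
  {A | ∃ V : Fin k → ℕ → Set X1,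
      (∀ i, ∀ l < ⌈cw a i * (n : ℝ)⌉₊, V i l ∈ 𝒱 i) ∧
      A = ⋂ i : Fin k, ⋂ l ∈ Finset.range ⌈cw a i * (n : ℝ)⌉₊, (T1^[l]) ⁻¹' V i l}

/-- `Λ^{𝐚,s}_{N,{𝒰_i}}(Z,f)`. -/
noncomputable def lamLocN (T1 : X1 → X1) (a : Fin k → ℝ) (𝒱 : Fin k → Set (Set X1))
    (f : X1 → ℝ) (s : ℝ) (N : ℕ) (Z : Set X1) : ℝ≥0∞ :=
  ⨅ (D : Set (ℕ × Set X1)) (_ : D.Countable)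
    (_ : ∀ p ∈ D, N ≤ p.1 ∧ MeasurableSet p.2 ∧ ∃ A ∈ jointFiber T1 a 𝒱 p.1, p.2 ⊆ A)
    (_ : Z ⊆ ⋃ p ∈ D, p.2),
    ∑' p : D, pterm T1 f (a 0) s p.1.1 p.1.2

/-- `Λ^{𝐚,s}_{{𝒰_i}}(Z,f)`. -/
noncomputable def lamLoc (T1 : X1 → X1) (a : Fin k → ℝ) (𝒱 : Fin k → Set (Set X1))
    (f : X1 → ℝ) (s : ℝ) (Z : Set X1) : ℝ≥0∞ :=
  ⨆ N : ℕ, lamLocN T1 a 𝒱 f s N Z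

/-- the local 𝐚-weighted topological pressure `P^𝐚(T₁, Z, {𝒰_i}, f)`, expressed through the
pulled-back covers `𝒱 i = τ_{i-1}^{-1} 𝒰_i`. -/
noncomputable def PLoc (T1 : X1 → X1) (a : Fin k → ℝ) (𝒱 : Fin k → Set (Set X1))
    (Z : Set X1) (f : X1 → ℝ) : EReal :=
  sInf (Real.toEReal '' {s : ℝ | lamLoc T1 a 𝒱 f s Z = 0})

/-- `W^{𝐚,s}_{N,{𝒰_i}}(Z,f)`. -/
noncomputable def wLocN (T1 : X1 → X1) (a : Fin k → ℝ) (𝒱 : Fin k → Set (Set X1))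
    (f : X1 → ℝ) (s : ℝ) (N : ℕ) (Z : Set X1) : ℝ≥0∞ :=
  ⨅ (D : Set (ℕ × Set X1 × ℝ≥0∞)) (_ : D.Countable)
    (_ : ∀ p ∈ D, N ≤ p.1 ∧ MeasurableSet p.2.1 ∧ 0 < p.2.2 ∧ p.2.2 ≠ ⊤ ∧
        ∃ A ∈ jointFiber T1 a 𝒱 p.1, p.2.1 ⊆ A)
    (_ : ∀ z ∈ Z, 1 ≤ ∑' p : D, (p.1.2.1).indicator (fun _ => p.1.2.2) z),
    ∑' p : D, p.1.2.2 * pterm T1 f (a 0) s p.1.1 p.1.2.1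

/-- `W^{𝐚,s}_{{𝒰_i}}(Z,f)`. -/
noncomputable def wLoc (T1 : X1 → X1) (a : Fin k → ℝ) (𝒱 : Fin k → Set (Set X1))
    (f : X1 → ℝ) (s : ℝ) (Z : Set X1) : ℝ≥0∞ :=
  ⨆ N : ℕ, wLocN T1 a 𝒱 f s N Z

/-- the local average 𝐚-weighted topological pressure `P_W^𝐚(T₁, Z, {𝒰_i}, f)`. -/
noncomputable def PWLoc (T1 : X1 → X1) (a : Fin k → ℝ) (𝒱 : Fin k → Set (Set X1))
    (Z : Set X1) (f : X1 → ℝ) : EReal :=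
  sInf (Real.toEReal '' {s : ℝ | wLoc T1 a 𝒱 f s Z = 0})

end Local

/-- iterated join `(𝒰)_0^{n-1} = ⋁_{l=0}^{n-1} T^{-l} 𝒰` of a cover. -/
def covJoinT {X : Type*} (T : X → X) (𝒰 : Set (Set X)) (n : ℕ) : Set (Set X) :=
  {A | ∃ u : ℕ → Set X, (∀ l < n, u l ∈ 𝒰) ∧
      A = ⋂ l ∈ Finset.range n, (T^[l]) ⁻¹' u l}

/-- the join `⋁_{j=i}^{k} 𝒱 j` of covers of a single space (in applications
`𝒱 j = τ_{j-1}^{-1} 𝒰_j`). -/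
def joinFrom {X1 : Type*} (𝒱 : Fin k → Set (Set X1)) (i : Fin k) : Set (Set X1) :=
  {A | ∃ V : Fin k → Set X1, (∀ j, i ≤ j → V j ∈ 𝒱 j) ∧ A = ⋂ j ∈ Finset.Ici i, V j}

/-- a finite measurable partition (indexed). -/
def IsPart {X : Type*} [MeasurableSpace X] {ι : Type*} (β : ι → Set X) : Prop :=
  (∀ i, MeasurableSet (β i)) ∧ (∀ i j, i ≠ j → Disjoint (β i) (β j)) ∧ ⋃ i, β i = Set.univ

/-- the static entropy `H_μ(β) = -∑ μ(B) log μ(B)` of a finite (indexed) partition. -/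
noncomputable def entH {X : Type*} [MeasurableSpace X] {ι : Type*} [Fintype ι]
    (μ : Measure X) (β : ι → Set X) : ℝ :=
  ∑ i, Real.negMulLog (μ (β i)).toReal

/-- the dynamical join `⋁_{l=0}^{n-1} T^{-l} β` of a partition. -/
def dynJoin {X : Type*} (T : X → X) {ι : Type*} (β : ι → Set X) (n : ℕ) :
    (Fin n → ι) → Set X :=
  fun c => ⋂ l : Fin n, (T^[(l : ℕ)]) ⁻¹' β (c l)

/-- the measure-theoretic entropy `h_μ(T, β) = lim_n (1/n) H_μ(⋁_{l<n} T^{-l}β)` of `T`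
relative to a finite partition. -/
noncomputable def hPart {X : Type*} [MeasurableSpace X] {ι : Type*} [Fintype ι]
    (μ : Measure X) (T : X → X) (β : ι → Set X) : EReal :=
  Filter.liminf (fun n : ℕ => ((entH μ (dynJoin T β n) / n : ℝ) : EReal)) Filter.atTop

/-- the Kolmogorov–Sinai entropy `h_μ(T)`. -/
noncomputable def hKS {X : Type*} [MeasurableSpace X] (μ : Measure X) (T : X → X) : EReal :=
  ⨆ p : (Σ m : ℕ, {β : Fin m → Set X // IsPart β}), hPart μ T p.2.1

/-- `H_μ(𝒰) = inf {H_μ(β) : β a finite measurable partition refining 𝒰}`. -/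
noncomputable def covH {X : Type*} [MeasurableSpace X] (μ : Measure X)
    (𝒰 : Set (Set X)) : ℝ :=
  sInf {h : ℝ | ∃ (m : ℕ) (β : Fin m → Set X), IsPart β ∧
      (∀ i, ∃ U ∈ 𝒰, β i ⊆ U) ∧ h = entH μ β}

/-- the local measure-theoretic entropy `h_μ(T, 𝒰) = lim_n (1/n) H_μ((𝒰)_0^{n-1})` of `T`
relative to an open cover. -/
noncomputable def hCov {X : Type*} [MeasurableSpace X] (μ : Measure X) (T : X → X)
    (𝒰 : Set (Set X)) : EReal :=
  Filter.liminf (fun n : ℕ => ((covH μ (covJoinT T 𝒰 n) / n : ℝ) : EReal)) Filter.atTop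

/-- `h⁺_μ(T,𝒰) = inf {h_μ(T,β) : β a finite measurable partition refining 𝒰}`. -/
noncomputable def hCovPlus {X : Type*} [MeasurableSpace X] (μ : Measure X) (T : X → X)
    (𝒰 : Set (Set X)) : EReal :=
  ⨅ p : (Σ m : ℕ, {β : Fin m → Set X // IsPart β ∧ ∀ i, ∃ U ∈ 𝒰, β i ⊆ U}),
    hPart μ T p.2.1

/-- the join `⋁_{j=i}^{k} γ j` of partitions of a single space (in applications
`γ j = τ_{j-1}^{-1} α_j`). -/
def partJoinFrom {X1 : Type*} {ι : Fin k → Type*} (γ : ∀ j, ι j → Set X1) (i : Fin k) :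
    (∀ j : {j : Fin k // i ≤ j}, ι j) → Set X1 :=
  fun c => ⋂ j : {j : Fin k // i ≤ j}, γ j (c j)

/-- the partition `⋁_{i=1}^k (γ_i)_0^{⌈(a_1+…+a_i)N⌉-1}` on the first space, where
`γ i = τ_{i-1}^{-1} α_i`. -/
def bigPartJoin {X1 : Type*} (T1 : X1 → X1) (a : Fin k → ℝ) {ι : Fin k → Type*}
    (γ : ∀ i, ι i → Set X1) (N : ℕ) :
    (∀ i : Fin k, Fin ⌈cw a i * (N : ℝ)⌉₊ → ι i) → Set X1 :=
  fun c => ⋂ i : Fin k, ⋂ l : Fin ⌈cw a i * (N : ℝ)⌉₊, (T1^[(l : ℕ)]) ⁻¹' γ i (c i l)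

/-- conditional entropy `H_μ(γ|β) = H_μ(γ ∨ β) - H_μ(β)`. -/
noncomputable def condEnt {X : Type*} [MeasurableSpace X] {ι κ : Type*} [Fintype ι] [Fintype κ]
    (μ : Measure X) (γ : ι → Set X) (β : κ → Set X) : ℝ :=
  entH μ (fun p : ι × κ => γ p.1 ∩ β p.2) - entH μ β

/-- the oscillation `w_f(⋁_{i=1}^k τ_{i-1}^{-1} 𝒰_i)` of `f` on the joined cover, where
`𝒱 i = τ_{i-1}^{-1} 𝒰_i`. -/
noncomputable def wfJoin {X1 : Type*} (f : X1 → ℝ) (𝒱 : Fin k → Set (Set X1)) : ℝ :=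
  sSup {d : ℝ | ∃ V : Fin k → Set X1, (∀ i, V i ∈ 𝒱 i) ∧
      ∃ x ∈ ⋂ i, V i, ∃ y ∈ ⋂ i, V i, d = |f x - f y|}

/-- the topological support of a measure. -/
def msupp {X : Type*} [TopologicalSpace X] [MeasurableSpace X] (μ : Measure X) : Set X :=
  {x | ∀ U : Set X, IsOpen U → x ∈ U → 0 < μ U}

section Join

variable {X : Type*}

/-- the join `⋁_{i ∈ s} (f i)⁻¹ 𝒰 i` of a finite family of pulled back covers. -/
def joinOn {ι : Type*} (s : Finset ι) (f : ι → X → X) (𝒰 : ι → Set (Set X)) : Set (Set X) :=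
  {A | ∃ U : ι → Set X, (∀ i ∈ s, U i ∈ 𝒰 i) ∧ A = ⋂ i ∈ s, f i ⁻¹' U i}

theorem joinOn_empty {ι : Type*} (f : ι → X → X) (𝒰 : ι → Set (Set X)) :
    joinOn ∅ f 𝒰 = {univ} := by
  ext A
  simp [joinOn]

theorem exists_inter_subset_joinOn_insert {ι : Type*} [DecidableEq ι] {s : Finset ι} {i : ι}
    (hi : i ∉ s) {f : ι → X → X} {𝒰 : ι → Set (Set X)} {V : Set X} (hV : V ∈ (f i ⁻¹' ·) '' 𝒰 i)
    {W : Set X} (hW : W ∈ joinOn s f 𝒰) : ∃ U ∈ joinOn (insert i s) f 𝒰, V ∩ W ⊆ U := by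
  obtain ⟨V, hV, rfl⟩ := hV
  obtain ⟨U, hU, rfl⟩ := hW
  have hne {j} (hj : j ∈ s) : j ≠ i := fun h => hi (h ▸ hj)
  refine ⟨_, ⟨Function.update U i V, fun j hj => ?_, rfl⟩, fun x hx => ?_⟩
  · rcases Finset.mem_insert.1 hj with rfl | hj
    · simpa using hV
    · simpa [hne hj] using hU j hj
  · simp only [mem_inter_iff, mem_iInter] at hx
    simp only [mem_iInter]
    intro j hj
    rcases Finset.mem_insert.1 hj with rfl | hj
    · simpa using hx.1
    · simpa [hne hj] using hx.2 j hj

theorem covJoinT_eq_joinOn (T : X → X) (𝒰 : Set (Set X)) (n : ℕ) :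
    covJoinT T 𝒰 n = joinOn (Finset.range n) (fun l => T^[l]) fun _ => 𝒰 := by
  simp [covJoinT, joinOn]

theorem joinFrom_eq_joinOn (𝒱 : Fin k → Set (Set X)) (i : Fin k) :
    joinFrom 𝒱 i = joinOn (Finset.Ici i) (fun _ => id) 𝒱 := by
  simp [joinFrom, joinOn]

end Join

section Entropy

variable {X Y : Type*} [MeasurableSpace X] [MeasurableSpace Y]

theorem entH_nonneg {ι : Type*} [Fintype ι] (μ : Measure X) [IsProbabilityMeasure μ]
    (β : ι → Set X) : 0 ≤ entH μ β :=
  Finset.sum_nonneg fun _ _ => Real.negMulLog_nonneg ENNReal.toReal_nonneg measureReal_le_one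

theorem entH_map {ι : Type*} [Fintype ι] {μ : Measure X} {f : X → Y} (hf : Measurable f)
    {β : ι → Set Y} (hβ : ∀ i, MeasurableSet (β i)) :
    entH (μ.map f) β = entH μ (fun i => f ⁻¹' β i) := by
  simp only [entH, Measure.map_apply hf (hβ _)]

theorem entH_comp_equiv {ι κ : Type*} [Fintype ι] [Fintype κ] (μ : Measure X) (β : ι → Set X)
    (e : κ ≃ ι) : entH μ (β ∘ e) = entH μ β :=
  e.sum_comp fun i => Real.negMulLog (μ (β i)).toReal

theorem negMulLog_le_of_le {x p q : ℝ} (hx : 0 ≤ x) (hp : x ≤ p) (hq : x ≤ q) :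
    Real.negMulLog x ≤ -(x * Real.log p) - x * Real.log q + p * q - x := by
  rcases hx.eq_or_lt with rfl | hx
  · simpa using mul_nonneg hp hq
  · have hp' := hx.trans_le hp
    have hq' := hx.trans_le hq
    have h := Real.log_le_sub_one_of_pos (div_pos (mul_pos hp' hq') hx)
    rw [Real.log_div (mul_pos hp' hq').ne' hx.ne', Real.log_mul hp'.ne' hq'.ne'] at h
    have h' := mul_le_mul_of_nonneg_left h hx.le
    rw [mul_sub x (p * q / x), mul_div_cancel₀ _ hx.ne'] at h'
    rw [Real.negMulLog]
    linarith

theorem IsPart.sum_measureReal_inter {ι : Type*} [Fintype ι] {β : ι → Set X} (hβ : IsPart β)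
    (μ : Measure X) [IsFiniteMeasure μ] {s : Set X} (hs : MeasurableSet s) :
    ∑ i, μ.real (s ∩ β i) = μ.real s := by
  rw [← measureReal_iUnion_fintype _ fun i => hs.inter (hβ.1 i), ← inter_iUnion, hβ.2.2,
    inter_univ]
  exact fun i j hij => (hβ.2.1 i j hij).mono inter_subset_right inter_subset_right

theorem entH_inter_le {ι κ : Type*} [Fintype ι] [Fintype κ] (μ : Measure X)
    [IsProbabilityMeasure μ] {β : ι → Set X} {γ : κ → Set X} (hβ : IsPart β) (hγ : IsPart γ) :
    entH μ (fun p : ι × κ => β p.1 ∩ γ p.2) ≤ entH μ β + entH μ γ := by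
  have hβs : ∑ i, μ.real (β i) = 1 := by
    simpa using hβ.sum_measureReal_inter μ MeasurableSet.univ
  have hγs : ∑ j, μ.real (γ j) = 1 := by
    simpa using hγ.sum_measureReal_inter μ MeasurableSet.univ
  have hβm (i) : ∑ j, μ.real (β i ∩ γ j) = μ.real (β i) := hγ.sum_measureReal_inter μ (hβ.1 i)
  have hγm (j) : ∑ i, μ.real (β i ∩ γ j) = μ.real (γ j) := by
    simpa only [inter_comm] using hβ.sum_measureReal_inter μ (hγ.1 j)
  calc entH μ (fun p : ι × κ => β p.1 ∩ γ p.2)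
      ≤ ∑ p : ι × κ, (-(μ.real (β p.1 ∩ γ p.2) * Real.log (μ.real (β p.1)))
          - μ.real (β p.1 ∩ γ p.2) * Real.log (μ.real (γ p.2))
          + μ.real (β p.1) * μ.real (γ p.2) - μ.real (β p.1 ∩ γ p.2)) :=
        Finset.sum_le_sum fun p _ => negMulLog_le_of_le measureReal_nonneg
          (measureReal_mono inter_subset_left) (measureReal_mono inter_subset_right)
    _ = (∑ i, -(μ.real (β i) * Real.log (μ.real (β i))))
          - (∑ j, μ.real (γ j) * Real.log (μ.real (γ j))) + 1 - 1 := by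
        simp only [Finset.sum_sub_distrib, Finset.sum_add_distrib]
        congr 2
        · congr 1
          · simp only [Fintype.sum_prod_type, Finset.sum_neg_distrib, ← Finset.sum_mul, hβm]
          · simp only [Fintype.sum_prod_type_right, ← Finset.sum_mul, hγm]
        · simp only [Fintype.sum_prod_type, ← Finset.mul_sum, hγs, mul_one, hβs]
        · simp only [Fintype.sum_prod_type, hβm, hβs]
    _ = entH μ β + entH μ γ := by
        simp only [entH, Real.negMulLog, measureReal_def, neg_mul, Finset.sum_neg_distrib]
        ring

theorem IsPart.comp_equiv {ι κ : Type*} {β : ι → Set X} (hβ : IsPart β) (e : κ ≃ ι) :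
    IsPart (β ∘ e) :=
  ⟨fun i => hβ.1 _, fun i j hij => hβ.2.1 _ _ (e.injective.ne hij), by
    rw [← hβ.2.2]; exact e.surjective.iUnion_comp β⟩

theorem IsPart.inter {ι κ : Type*} {β : ι → Set X} {γ : κ → Set X} (hβ : IsPart β)
    (hγ : IsPart γ) : IsPart (fun p : ι × κ => β p.1 ∩ γ p.2) := by
  refine ⟨fun p => (hβ.1 _).inter (hγ.1 _), fun p q hpq => ?_, ?_⟩
  · by_cases h : p.1 = q.1
    · exact (hγ.2.1 _ _ fun h' => hpq (Prod.ext h h')).mono inter_subset_right inter_subset_right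
    · exact (hβ.2.1 _ _ h).mono inter_subset_left inter_subset_left
  · refine eq_univ_of_forall fun x => ?_
    obtain ⟨i, hi⟩ := mem_iUnion.1 (hβ.2.2 ▸ mem_univ x)
    obtain ⟨j, hj⟩ := mem_iUnion.1 (hγ.2.2 ▸ mem_univ x)
    exact mem_iUnion.2 ⟨(i, j), hi, hj⟩

theorem IsPart.preimage {ι : Type*} {β : ι → Set Y} (hβ : IsPart β) {f : X → Y}
    (hf : Measurable f) : IsPart (fun i => f ⁻¹' β i) :=
  ⟨fun i => hf (hβ.1 i), fun i j hij => (hβ.2.1 i j hij).preimage f, by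
    rw [← preimage_iUnion, hβ.2.2, preimage_univ]⟩

theorem IsPart.dynJoin {ι : Type*} {β : ι → Set X} (hβ : IsPart β) {T : X → X}
    (hT : Measurable T) (n : ℕ) : IsPart (dynJoin T β n) := by
  refine ⟨fun c => MeasurableSet.iInter fun l => (hT.iterate l) (hβ.1 _), fun c d hcd => ?_, ?_⟩
  · obtain ⟨l, hl⟩ := Function.ne_iff.1 hcd
    exact ((hβ.2.1 _ _ hl).preimage _).mono (iInter_subset _ l) (iInter_subset _ l)
  · refine eq_univ_of_forall fun x => ?_
    choose c hc using fun l : Fin n => mem_iUnion.1 (hβ.2.2 ▸ mem_univ (T^[(l : ℕ)] x))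
    exact mem_iUnion.2 ⟨c, mem_iInter.2 hc⟩

/-- a cover that is refined by some finite measurable partition. -/
def Refinable (𝒰 : Set (Set X)) : Prop :=
  ∃ (m : ℕ) (β : Fin m → Set X), IsPart β ∧ ∀ i, ∃ U ∈ 𝒰, β i ⊆ U

theorem Refinable.of_isPart {ι : Type*} [Fintype ι] {β : ι → Set X} (hβ : IsPart β)
    {𝒰 : Set (Set X)} (h : ∀ i, ∃ U ∈ 𝒰, β i ⊆ U) : Refinable 𝒰 :=
  ⟨_, β ∘ (Fintype.equivFin ι).symm, hβ.comp_equiv _, fun _ => h _⟩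

theorem Refinable.of_finite {𝒰 : Set (Set X)} (hf : 𝒰.Finite)
    (hm : ∀ U ∈ 𝒰, MeasurableSet U) (hU : ⋃₀ 𝒰 = univ) : Refinable 𝒰 := by
  obtain ⟨m, f, -, rfl⟩ := hf.fin_param
  rw [sUnion_range] at hU
  refine ⟨m, disjointed f, ⟨fun i => ?_, fun i j hij => disjoint_disjointed f hij, ?_⟩,
    fun i => ⟨f i, mem_range_self i, disjointed_subset f i⟩⟩
  · exact disjointedRec (fun _ _ ht => ht.diff (hm _ (mem_range_self _))) (hm _ (mem_range_self i))
  · rw [iUnion_disjointed, hU]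

theorem covH_bddBelow (μ : Measure X) [IsProbabilityMeasure μ] (𝒰 : Set (Set X)) :
    BddBelow {h : ℝ | ∃ (m : ℕ) (β : Fin m → Set X), IsPart β ∧
      (∀ i, ∃ U ∈ 𝒰, β i ⊆ U) ∧ h = entH μ β} := by
  refine ⟨0, ?_⟩
  rintro _ ⟨m, β, -, -, rfl⟩
  exact entH_nonneg μ β

theorem covH_nonneg (μ : Measure X) [IsProbabilityMeasure μ] (𝒰 : Set (Set X)) :
    0 ≤ covH μ 𝒰 := by
  refine Real.sInf_nonneg ?_
  rintro _ ⟨m, β, -, -, rfl⟩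
  exact entH_nonneg μ β

theorem covH_le_entH {ι : Type*} [Fintype ι] (μ : Measure X) [IsProbabilityMeasure μ]
    {β : ι → Set X} (hβ : IsPart β) {𝒰 : Set (Set X)} (h : ∀ i, ∃ U ∈ 𝒰, β i ⊆ U) :
    covH μ 𝒰 ≤ entH μ β :=
  csInf_le (covH_bddBelow μ 𝒰) ⟨_, β ∘ (Fintype.equivFin ι).symm, hβ.comp_equiv _, fun _ => h _,
    (entH_comp_equiv μ β _).symm⟩

theorem Refinable.le_covH {𝒰 : Set (Set X)} (h𝒰 : Refinable 𝒰) {μ : Measure X} {c : ℝ}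
    (h : ∀ (m : ℕ) (β : Fin m → Set X), IsPart β → (∀ i, ∃ U ∈ 𝒰, β i ⊆ U) → c ≤ entH μ β) :
    c ≤ covH μ 𝒰 := by
  obtain ⟨m, β, hβ, hr⟩ := h𝒰
  refine le_csInf ⟨_, m, β, hβ, hr, rfl⟩ ?_
  rintro _ ⟨m, β, hβ, hr, rfl⟩
  exact h m β hβ hr

theorem Refinable.preimage {𝒱 : Set (Set Y)} (h𝒱 : Refinable 𝒱) {f : X → Y} (hf : Measurable f)
    {𝒰 : Set (Set X)} (h : ∀ V ∈ 𝒱, ∃ U ∈ 𝒰, f ⁻¹' V ⊆ U) : Refinable 𝒰 := by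
  obtain ⟨m, β, hβ, hr⟩ := h𝒱
  refine ⟨m, _, hβ.preimage hf, fun i => ?_⟩
  obtain ⟨V, hV, hi⟩ := hr i
  obtain ⟨U, hU, hVU⟩ := h V hV
  exact ⟨U, hU, (preimage_mono hi).trans hVU⟩

theorem covH_le_covH_map {μ : Measure X} [IsProbabilityMeasure μ] {𝒱 : Set (Set Y)}
    (h𝒱 : Refinable 𝒱) {f : X → Y} (hf : Measurable f) {𝒰 : Set (Set X)}
    (h : ∀ V ∈ 𝒱, ∃ U ∈ 𝒰, f ⁻¹' V ⊆ U) : covH μ 𝒰 ≤ covH (μ.map f) 𝒱 := by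
  refine h𝒱.le_covH fun m β hβ hr => ?_
  rw [entH_map hf hβ.1]
  refine covH_le_entH μ (hβ.preimage hf) fun i => ?_
  obtain ⟨V, hV, hi⟩ := hr i
  obtain ⟨U, hU, hVU⟩ := h V hV
  exact ⟨U, hU, (preimage_mono hi).trans hVU⟩

theorem Refinable.inter {𝒱 𝒲 𝒰 : Set (Set X)} (h𝒱 : Refinable 𝒱) (h𝒲 : Refinable 𝒲)
    (h : ∀ V ∈ 𝒱, ∀ W ∈ 𝒲, ∃ U ∈ 𝒰, V ∩ W ⊆ U) : Refinable 𝒰 := by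
  obtain ⟨m, β, hβ, hr⟩ := h𝒱
  obtain ⟨n, γ, hγ, hs⟩ := h𝒲
  refine .of_isPart (hβ.inter hγ) fun p => ?_
  obtain ⟨V, hV, hi⟩ := hr p.1
  obtain ⟨W, hW, hj⟩ := hs p.2
  obtain ⟨U, hU, hVW⟩ := h V hV W hW
  exact ⟨U, hU, (inter_subset_inter hi hj).trans hVW⟩

theorem covH_le_add {μ : Measure X} [IsProbabilityMeasure μ] {𝒱 𝒲 𝒰 : Set (Set X)}
    (h𝒱 : Refinable 𝒱) (h𝒲 : Refinable 𝒲)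
    (h : ∀ V ∈ 𝒱, ∀ W ∈ 𝒲, ∃ U ∈ 𝒰, V ∩ W ⊆ U) : covH μ 𝒰 ≤ covH μ 𝒱 + covH μ 𝒲 := by
  rw [← sub_le_iff_le_add]
  refine h𝒱.le_covH fun m β hβ hr => ?_
  rw [sub_le_comm]
  refine h𝒲.le_covH fun n γ hγ hs => ?_
  rw [sub_le_iff_le_add']
  refine (covH_le_entH μ (hβ.inter hγ) fun p => ?_).trans (entH_inter_le μ hβ hγ)
  obtain ⟨V, hV, hi⟩ := hr p.1
  obtain ⟨W, hW, hj⟩ := hs p.2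
  obtain ⟨U, hU, hVW⟩ := h V hV W hW
  exact ⟨U, hU, (inter_subset_inter hi hj).trans hVW⟩

theorem Refinable.singleton_univ : Refinable ({univ} : Set (Set X)) :=
  .of_finite (finite_singleton _) (by simp) (by simp)

theorem covH_singleton_univ (μ : Measure X) [IsProbabilityMeasure μ] : covH μ {univ} = 0 := by
  refine le_antisymm ?_ (covH_nonneg μ _)
  refine (covH_le_entH μ (β := fun _ : Unit => univ) ⟨by simp, by simp, iUnion_const _⟩
    (by simp)).trans ?_
  simp [entH]

theorem Refinable.joinOn {ι : Type*} (s : Finset ι) {f : ι → X → X}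
    (hf : ∀ i, Measurable (f i)) {𝒰 : ι → Set (Set X)} (h𝒰 : ∀ i ∈ s, Refinable (𝒰 i)) :
    Refinable (joinOn s f 𝒰) := by
  classical
  induction s using Finset.induction_on with
  | empty => exact joinOn_empty f 𝒰 ▸ singleton_univ
  | insert i s hi ih =>
    refine Refinable.inter ((h𝒰 i (s.mem_insert_self i)).preimage (hf i) fun V hV =>
      ⟨_, mem_image_of_mem _ hV, subset_rfl⟩) (ih fun j hj => h𝒰 j (Finset.mem_insert_of_mem hj))
      fun V hV W hW => exists_inter_subset_joinOn_insert hi hV hW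

theorem covH_joinOn_le {ι : Type*} (s : Finset ι) {μ : Measure X} [IsProbabilityMeasure μ]
    {f : ι → X → X} (hf : ∀ i, MeasurePreserving (f i) μ μ) {𝒰 : ι → Set (Set X)}
    (h𝒰 : ∀ i ∈ s, Refinable (𝒰 i)) : covH μ (joinOn s f 𝒰) ≤ ∑ i ∈ s, covH μ (𝒰 i) := by
  classical
  induction s using Finset.induction_on with
  | empty => simp [joinOn_empty, covH_singleton_univ]
  | insert i s hi ih =>
    have hs : ∀ j ∈ s, Refinable (𝒰 j) := fun j hj => h𝒰 j (Finset.mem_insert_of_mem hj)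
    have hU := h𝒰 i (s.mem_insert_self i)
    have hV : ∀ V ∈ 𝒰 i, ∃ U ∈ (f i ⁻¹' ·) '' 𝒰 i, f i ⁻¹' V ⊆ U :=
      fun V hV => ⟨_, mem_image_of_mem _ hV, subset_rfl⟩
    rw [Finset.sum_insert hi]
    refine (covH_le_add (hU.preimage (hf i).measurable hV) (.joinOn s (fun j => (hf j).measurable) hs)
      fun V hV W hW => exists_inter_subset_joinOn_insert hi hV hW).trans (add_le_add ?_ (ih hs))
    simpa only [(hf i).map_eq] using covH_le_covH_map (μ := μ) hU (hf i).measurable hV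

theorem Refinable.covJoinT {𝒰 : Set (Set X)} (h𝒰 : Refinable 𝒰) {T : X → X} (hT : Measurable T)
    (n : ℕ) : Refinable (covJoinT T 𝒰 n) := by
  rw [covJoinT_eq_joinOn]
  exact .joinOn _ hT.iterate fun _ _ => h𝒰

theorem Refinable.joinFrom {𝒱 : Fin k → Set (Set X)} (i : Fin k)
    (h𝒱 : ∀ j, i ≤ j → Refinable (𝒱 j)) : Refinable (joinFrom 𝒱 i) := by
  rw [joinFrom_eq_joinOn]
  exact .joinOn _ (fun _ => measurable_id) fun j hj => h𝒱 j (Finset.mem_Ici.1 hj)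

theorem covH_covJoinT_zero (μ : Measure X) [IsProbabilityMeasure μ] (T : X → X)
    (𝒰 : Set (Set X)) : covH μ (covJoinT T 𝒰 0) = 0 := by
  rw [covJoinT_eq_joinOn, Finset.range_zero, joinOn_empty, covH_singleton_univ]

theorem subadditive_covH_covJoinT {μ : Measure X} [IsProbabilityMeasure μ] {T : X → X}
    (hT : MeasurePreserving T μ μ) {𝒰 : Set (Set X)} (h𝒰 : Refinable 𝒰) :
    Subadditive fun n => covH μ (covJoinT T 𝒰 n) := by
  intro m n
  have hmn := hT.iterate m
  have hV : ∀ V ∈ covJoinT T 𝒰 n, ∃ U ∈ (T^[m] ⁻¹' ·) '' covJoinT T 𝒰 n, T^[m] ⁻¹' V ⊆ U :=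
    fun V hV => ⟨_, mem_image_of_mem _ hV, subset_rfl⟩
  have hn := h𝒰.covJoinT hT.measurable n
  refine (covH_le_add (h𝒰.covJoinT hT.measurable m) (hn.preimage hmn.measurable hV) ?_).trans
    (add_le_add le_rfl ?_)
  swap
  · simpa only [hmn.map_eq] using covH_le_covH_map (μ := μ) hn hmn.measurable hV
  rintro _ ⟨u, hu, rfl⟩ _ ⟨_, ⟨v, hv, rfl⟩, rfl⟩
  refine ⟨_, ⟨fun l => if l < m then u l else v (l - m), fun l hl => ?_, rfl⟩, fun x hx => ?_⟩
  · dsimp only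
    split_ifs with h
    · exact hu l h
    · exact hv _ (by omega)
  · simp only [mem_inter_iff, mem_iInter, mem_preimage, Finset.mem_range] at hx ⊢
    intro l hl
    split_ifs with h
    · exact hx.1 l h
    · have := hx.2 (l - m) (by omega)
      rwa [← Function.iterate_add_apply, Nat.sub_add_cancel (not_lt.1 h)] at this

theorem tendsto_covH_covJoinT {μ : Measure X} [IsProbabilityMeasure μ] {T : X → X}
    (hT : MeasurePreserving T μ μ) {𝒰 : Set (Set X)} (h𝒰 : Refinable 𝒰) :
    ∃ L : ℝ, hCov μ T 𝒰 = L ∧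
      Tendsto (fun n : ℕ => covH μ (covJoinT T 𝒰 n) / n) atTop (𝓝 L) := by
  have h := (subadditive_covH_covJoinT hT h𝒰).tendsto_lim ⟨0, by
    rintro _ ⟨n, rfl⟩
    exact div_nonneg (covH_nonneg μ _) n.cast_nonneg⟩
  exact ⟨_, ((continuous_coe_real_ereal.tendsto _).comp h).liminf_eq, h⟩

end Entropy

theorem tendsto_comp_div_natCast {u : ℕ → ℝ} (hu : u 0 = 0) {L α : ℝ}
    (hL : Tendsto (fun n : ℕ => u n / n) atTop (𝓝 L)) (hα : 0 ≤ α) {d : ℕ → ℕ}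
    (hd : Tendsto (fun N : ℕ => (d N : ℝ) / N) atTop (𝓝 α)) :
    Tendsto (fun N : ℕ => u (d N) / N) atTop (𝓝 (α * L)) := by
  have heq (N : ℕ) : u (d N) / N = (d N : ℝ) / N * (u (d N) / d N) := by
    rcases eq_or_ne (d N) 0 with h | h
    · simp [h, hu]
    · have : (d N : ℝ) ≠ 0 := Nat.cast_ne_zero.2 h
      field_simp
  simp only [heq]
  rcases hα.eq_or_lt with rfl | hα
  · rw [zero_mul]
    obtain ⟨C, hC⟩ := (Metric.isBounded_range_of_tendsto _ hL).exists_norm_le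
    exact hd.zero_mul_isBoundedUnder_le (isBoundedUnder_of ⟨C, fun N => hC _ ⟨d N, rfl⟩⟩)
  · refine hd.mul (hL.comp ?_)
    refine tendsto_natCast_atTop_iff.1 ((hd.pos_mul_atTop hα tendsto_natCast_atTop_atTop).congr' ?_)
    filter_upwards [eventually_ne_atTop 0] with N hN
    exact div_mul_cancel₀ _ (Nat.cast_ne_zero.2 hN)

/-- the time `⌈(a_1+…+a_{i-1})N⌉` from which on the first `i-1` covers impose no condition. -/
noncomputable def startTime (a : Fin k → ℝ) (N : ℕ) (i : Fin k) : ℕ :=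
  ⌈(∑ j ∈ Finset.Iio i, a j) * (N : ℝ)⌉₊

theorem cw_eq_add (a : Fin k → ℝ) (i : Fin k) : cw a i = (∑ j ∈ Finset.Iio i, a j) + a i := by
  rw [cw, ← Finset.Iio_insert, Finset.sum_insert (by simp), add_comm]

theorem startTime_le (a : Fin k → ℝ) (N : ℕ) {i : Fin k} {t : ℕ}
    (h : ∀ j < i, ⌈cw a j * (N : ℝ)⌉₊ ≤ t) : startTime a N i ≤ t := by
  obtain ⟨_ | n, hn⟩ := i
  · have : Finset.Iio (⟨0, hn⟩ : Fin k) = ∅ := by ext; simp [Fin.lt_def]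
    simp [startTime, this]
  · have : Finset.Iio (⟨n + 1, hn⟩ : Fin k) = Finset.Iic ⟨n, by omega⟩ := by
      ext; simp [Fin.lt_def, Fin.le_def]
    rw [startTime, this]
    exact h ⟨n, by omega⟩ (by simp [Fin.lt_def])

theorem startTime_le_ceil {a : Fin k → ℝ} (ha : ∀ i, 0 ≤ a i) (N : ℕ) (i : Fin k) :
    startTime a N i ≤ ⌈cw a i * (N : ℝ)⌉₊ := by
  rw [startTime, cw_eq_add]
  gcongr
  exact le_add_of_nonneg_right (ha i)

theorem tendsto_duration {a : Fin k → ℝ} (ha : ∀ i, 0 ≤ a i) (i : Fin k) :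
    Tendsto (fun N : ℕ => ((⌈cw a i * (N : ℝ)⌉₊ - startTime a N i : ℕ) : ℝ) / N) atTop
      (𝓝 (a i)) := by
  have hs : 0 ≤ ∑ j ∈ Finset.Iio i, a j := Finset.sum_nonneg fun j _ => ha j
  have hc : 0 ≤ cw a i := Finset.sum_nonneg fun j _ => ha j
  have h := ((tendsto_nat_ceil_mul_div_atTop hc).comp tendsto_natCast_atTop_atTop).sub
    ((tendsto_nat_ceil_mul_div_atTop hs).comp tendsto_natCast_atTop_atTop)
  rw [cw_eq_add, add_sub_cancel_left, ← cw_eq_add] at h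
  refine h.congr fun N => ?_
  rw [Nat.cast_sub (startTime_le_ceil ha N i), sub_div]
  rfl

theorem covH_jointFiber_le {X : Type*} [MeasurableSpace X] {μ : Measure X} [IsProbabilityMeasure μ]
    {T : X → X} (hT : MeasurePreserving T μ μ) (a : Fin k → ℝ)
    {𝒱 : Fin k → Set (Set X)} (h𝒱 : ∀ i, Refinable (𝒱 i)) (N : ℕ) :
    covH μ (jointFiber T a 𝒱 N) ≤
      ∑ i, covH μ (covJoinT T (joinFrom 𝒱 i) (⌈cw a i * (N : ℝ)⌉₊ - startTime a N i)) := by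
  have hW (i : Fin k) : Refinable
      (covJoinT T (joinFrom 𝒱 i) (⌈cw a i * (N : ℝ)⌉₊ - startTime a N i)) :=
    (Refinable.joinFrom i fun j _ => h𝒱 j).covJoinT hT.measurable _
  refine le_trans ?_ (covH_joinOn_le Finset.univ (fun i => hT.iterate (startTime a N i))
    fun i _ => hW i)
  have hJ := Refinable.joinOn Finset.univ (fun i => hT.measurable.iterate (startTime a N i))
    fun i _ => hW i
  have href : ∀ A ∈ joinOn Finset.univ (fun i => T^[startTime a N i]) (fun i =>
      covJoinT T (joinFrom 𝒱 i) (⌈cw a i * (N : ℝ)⌉₊ - startTime a N i)),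
      ∃ U ∈ jointFiber T a 𝒱 N, id ⁻¹' A ⊆ U := by
    rintro _ ⟨U, hU, rfl⟩
    choose u hu hUu using fun i => hU i (Finset.mem_univ i)
    have key (j : Fin k) (t : ℕ) : ∃ V, t < ⌈cw a j * (N : ℝ)⌉₊ →
        V ∈ 𝒱 j ∧ (⋂ i ∈ Finset.univ, T^[startTime a N i] ⁻¹' U i) ⊆ T^[t] ⁻¹' V := by
      by_cases ht : t < ⌈cw a j * (N : ℝ)⌉₊
      swap
      · exact ⟨∅, fun h => absurd h ht⟩
      obtain ⟨i, hi, hmin⟩ := WellFounded.has_min (wellFounded_lt (α := Fin k))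
        {i | t < ⌈cw a i * (N : ℝ)⌉₊} ⟨j, ht⟩
      have hst : startTime a N i ≤ t := startTime_le a N fun l hl => not_lt.1 fun h => hmin l h hl
      have hij : i ≤ j := not_lt.1 (hmin j ht)
      have hlt : t - startTime a N i < ⌈cw a i * (N : ℝ)⌉₊ - startTime a N i :=
        Nat.sub_lt_sub_right hst hi
      obtain ⟨V, hV, hVu⟩ := hu i _ hlt
      refine ⟨V j, fun _ => ⟨hV j hij, fun x hx => ?_⟩⟩
      have h1 := mem_iInter₂.1 hx i (Finset.mem_univ i)
      rw [hUu i] at h1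
      have h2 := mem_iInter₂.1 h1 _ (Finset.mem_range.2 hlt)
      rw [mem_preimage, hVu, ← Function.iterate_add_apply, Nat.sub_add_cancel hst] at h2
      exact mem_iInter₂.1 h2 j (Finset.mem_Ici.2 hij)
    choose V hV using key
    exact ⟨_, ⟨V, fun i l hl => (hV i l hl).1, rfl⟩, subset_iInter fun i => subset_iInter₂ fun l hl =>
      (hV i l (Finset.mem_range.1 hl)).2⟩
  simpa using covH_le_covH_map (μ := μ) hJ measurable_id href

theorem hCov_le_hKS_map {X Y : Type*} [MeasurableSpace X] [MeasurableSpace Y] {μ : Measure X}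
    [IsProbabilityMeasure μ] {T : X → X} {S : Y → Y} (hS : Measurable S) {τ : X → Y}
    (hτ : Measurable τ) (hτS : τ ∘ T = S ∘ τ) {𝒰 : Set (Set X)} {𝒱 : Set (Set Y)}
    (h𝒱 : Refinable 𝒱) (h : ∀ V ∈ 𝒱, ∃ U ∈ 𝒰, τ ⁻¹' V ⊆ U) :
    hCov μ T 𝒰 ≤ hKS (μ.map τ) S := by
  obtain ⟨m, α, hα, hr⟩ := h𝒱
  refine le_trans ?_ (le_iSup (fun p : (Σ m : ℕ, {β : Fin m → Set Y // IsPart β}) =>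
    hPart (μ.map τ) S p.2.1) ⟨m, α, hα⟩)
  refine liminf_le_liminf (Eventually.of_forall fun n => ?_)
  rw [EReal.coe_le_coe_iff, entH_map hτ (hα.dynJoin hS n).1]
  gcongr
  refine covH_le_entH μ ((hα.dynJoin hS n).preimage hτ) fun c => ?_
  have hU (i : Fin m) : ∃ U ∈ 𝒰, τ ⁻¹' α i ⊆ U := by
    obtain ⟨V, hV, hi⟩ := hr i
    obtain ⟨U, hU, hVU⟩ := h V hV
    exact ⟨U, hU, (preimage_mono hi).trans hVU⟩
  choose U hU hαU using hU
  refine ⟨_, ⟨fun l => if hl : l < n then U (c ⟨l, hl⟩) else ∅, fun l hl => by simp [hl, hU], rfl⟩,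
    fun x hx => mem_iInter₂.2 fun l hl => ?_⟩
  have hl := Finset.mem_range.1 hl
  have h1 := mem_iInter.1 hx ⟨l, hl⟩
  have hsemi : Function.Semiconj τ T S := congrFun hτS
  simp only [mem_preimage, hl, dite_true]
  refine hαU _ ?_
  rwa [mem_preimage, (hsemi.iterate_right l).eq]

/-- For `μ ∈ M(X₁,T₁)` and open covers `𝒰_i` of `X_i`,
`limsup_N (1/N) H_μ(⋁_{i=1}^k (τ_{i-1}^{-1}𝒰_i)_0^{⌈(a_1+…+a_i)N⌉-1})
  ≤ ∑_i a_i h_μ(T₁, ⋁_{j=i}^k τ_{j-1}^{-1}𝒰_j) ≤ ∑_i a_i h_{τ_{i-1}μ}(T_i)`. -/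
theorem cover_entropy_limsup_le
    {k : ℕ} [NeZero k]
    (X : Fin k → Type) [∀ i, MetricSpace (X i)] [∀ i, CompactSpace (X i)]
    [∀ i, MeasurableSpace (X i)] [∀ i, BorelSpace (X i)]
    (T : ∀ i, X i → X i) (hT : ∀ i, Continuous (T i))
    (τ : ∀ i, X 0 → X i) (hτ0 : τ 0 = id)
    (hτc : ∀ i, Continuous (τ i)) (hτs : ∀ i, Function.Surjective (τ i))
    (hτe : ∀ i, τ i ∘ T 0 = T i ∘ τ i)
    (hchain : ∀ i j : Fin k, i ≤ j → ∃ p : X i → X j,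
        Continuous p ∧ p ∘ T i = T j ∘ p ∧ p ∘ τ i = τ j)
    (a : Fin k → ℝ) (ha1 : 0 < a 0) (ha : ∀ i, 0 ≤ a i)
    (μ : Measure (X 0)) [IsProbabilityMeasure μ] (hμ : μ.map (T 0) = μ)
    (𝒰 : ∀ i, Set (Set (X i))) (h𝒰 : ∀ i, IsOpenCover (𝒰 i)) :
    (Filter.limsup
        (fun N : ℕ =>
          ((covH μ (jointFiber (T 0) a (fun i => pullCov (τ i) (𝒰 i)) N) / N : ℝ) : EReal))
        Filter.atTop
      ≤ ∑ i : Fin k, ((a i : ℝ) : EReal) *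
          hCov μ (T 0) (joinFrom (fun j => pullCov (τ j) (𝒰 j)) i))
    ∧ (∑ i : Fin k, ((a i : ℝ) : EReal) *
          hCov μ (T 0) (joinFrom (fun j => pullCov (τ j) (𝒰 j)) i)
        ≤ ∑ i : Fin k, ((a i : ℝ) : EReal) * hKS (μ.map (τ i)) (T i)) := by
  have hTp : MeasurePreserving (T 0) μ μ := ⟨(hT 0).measurable, hμ⟩
  have hU (i : Fin k) : Refinable (𝒰 i) :=
    .of_finite (h𝒰 i).1 (fun U hU => ((h𝒰 i).2.1 U hU).measurableSet) (h𝒰 i).2.2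
  have h𝒱 (i : Fin k) : Refinable (pullCov (τ i) (𝒰 i)) :=
    (hU i).preimage (hτc i).measurable fun V hV => ⟨_, mem_image_of_mem _ hV, subset_rfl⟩
  constructor
  · choose L hL hLt using fun i : Fin k => tendsto_covH_covJoinT hTp
      (Refinable.joinFrom (𝒱 := fun j => pullCov (τ j) (𝒰 j)) i fun j _ => h𝒱 j)
    have hlim := tendsto_finsetSum Finset.univ fun (i : Fin k) _ =>
      tendsto_comp_div_natCast (covH_covJoinT_zero μ _ _) (hLt i) (ha i) (tendsto_duration ha i)
    have hsum : ∑ i, ((a i : ℝ) : EReal) *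
        hCov μ (T 0) (joinFrom (fun j => pullCov (τ j) (𝒰 j)) i) =
          ((∑ i, a i * L i : ℝ) : EReal) := by
      let φ : ℝ →+ EReal := ⟨⟨Real.toEReal, EReal.coe_zero⟩, EReal.coe_add⟩
      simp only [hL, ← EReal.coe_mul]
      exact (map_sum φ _ _).symm
    rw [hsum, ← ((continuous_coe_real_ereal.tendsto _).comp hlim).limsup_eq]
    refine limsup_le_limsup (Eventually.of_forall fun N => ?_)
    rw [Function.comp_apply, EReal.coe_le_coe_iff, ← Finset.sum_div]
    gcongr
    exact covH_jointFiber_le hTp a h𝒱 N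
  · refine Finset.sum_le_sum fun i _ => mul_le_mul_of_nonneg_left ?_ (EReal.coe_nonneg.2 (ha i))
    have hP (j : Fin k) : ∃ 𝒲 : Set (Set (X i)), i ≤ j →
        Refinable 𝒲 ∧ ∀ P ∈ 𝒲, τ i ⁻¹' P ∈ pullCov (τ j) (𝒰 j) := by
      by_cases hij : i ≤ j
      swap
      · exact ⟨∅, fun h => absurd h hij⟩
      obtain ⟨p, hp, -, hpτ⟩ := hchain i j hij
      refine ⟨pullCov p (𝒰 j), fun _ => ⟨(hU j).preimage hp.measurable fun V hV =>
        ⟨_, mem_image_of_mem _ hV, subset_rfl⟩, ?_⟩⟩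
      rintro _ ⟨U, hU, rfl⟩
      exact ⟨U, hU, by rw [← hpτ]; rfl⟩
    choose 𝒲 h𝒲 using hP
    refine hCov_le_hKS_map (hT i).measurable (hτc i).measurable (hτe i)
      (Refinable.joinFrom (𝒱 := 𝒲) i fun j hj => (h𝒲 j hj).1) ?_
    rintro _ ⟨V, hV, rfl⟩
    exact ⟨_, ⟨fun j => τ i ⁻¹' V j, fun j hj => (h𝒲 j hj).2 _ (hV j hj), rfl⟩,
      by simp only [preimage_iInter]; rfl⟩

end WTP
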